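/- The smallest subset of Q containing {a, b, c} and closed under the six maps x ↦ x ▷ a, x ▷ b, x ▷ c, x ▷⁻¹ a, x ▷⁻¹ b, x ▷⁻¹ c has at most n(2t+1) + 2 elements. (This is the upper-bound half of the theorem that |Q_{(2,n)}(L_k)| = n|k| + 2 for k = 2t+1 odd.) -/

import Mathlib

/-- A quandle in the paper's (right-action) conventions: `op x y` is `x ▷ y` (written `x^y`)
and `inv x y` is `x ▷⁻¹ y` (written `x^{ȳ}`). -/
structure LinkQuandle (Q : Type*) where
  op : Q → Q → Q
  inv : Q → Q → Q
  idem : ∀ x, op x x = x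
  inv_op : ∀ x y, inv (op x y) y = x
  op_inv : ∀ x y, op (inv x y) y = x
  distrib : ∀ x y z, op (op x y) z = op (op x z) (op y z)

/-- `opPow q y n x` is `x^{yⁿ}`: act on `x` by `y`, `n` times. -/
def LinkQuandle.opPow {Q : Type*} (q : LinkQuandle Q) (y : Q) (n : ℕ) (x : Q) : Q :=
  (fun z => q.op z y)^[n] x

/-- `pairPow q y z t x` is `x^{(yz)^t}`: act on `x` by `y` then `z`, `t` times. -/
def LinkQuandle.pairPow {Q : Type*} (q : LinkQuandle Q) (y z : Q) (t : ℕ) (x : Q) : Q :=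
  (fun w => q.op (q.op w y) z)^[t] x

/-- The smallest subset of `Q` containing `S` and closed under acting (and inversely acting)
by every element of `S`. -/
def LinkQuandle.genClosure {Q : Type*} (q : LinkQuandle Q) (S : Set Q) : Set Q :=
  ⋂₀ {T : Set Q | S ⊆ T ∧ ∀ x ∈ T, ∀ s ∈ S, q.op x s ∈ T ∧ q.inv x s ∈ T}

namespace LinkQuandle

variable {Q : Type*} (q : LinkQuandle Q)

/-- The permutation `x ↦ x ▷ y` of the quandle. -/
def act (y : Q) : Equiv.Perm Q where
  toFun x := q.op x y
  invFun x := q.inv x y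
  left_inv x := q.inv_op x y
  right_inv x := q.op_inv x y

/-- The permutations that transport the right translations by conjugation. -/
def translationNormalizer : Subgroup (Equiv.Perm Q) where
  carrier := {g | ∀ x, q.act (g x) = g * q.act x * g⁻¹}
  one_mem' x := by simp
  mul_mem' {g h} hg hh x := by
    rw [Equiv.Perm.mul_apply, hg, hh]
    group
  inv_mem' {g} hg x := by
    have h := hg (g⁻¹ x)
    rw [← Equiv.Perm.mul_apply, mul_inv_cancel, Equiv.Perm.one_apply] at h
    rw [h]
    group

lemma act_mem_translationNormalizer (y : Q) : q.act y ∈ q.translationNormalizer := by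
  intro x
  rw [eq_mul_inv_iff_mul_eq]
  ext z
  exact (q.distrib z x y).symm

lemma act_apply_of_mem {g : Equiv.Perm Q} (hg : g ∈ q.translationNormalizer) (x : Q) :
    q.act (g x) = g * q.act x * g⁻¹ := hg x

lemma opPow_eq (y : Q) (n : ℕ) (x : Q) : q.opPow y n x = (q.act y ^ n) x := by
  rw [← Equiv.Perm.iterate_eq_pow]
  rfl

lemma pairPow_eq (y z : Q) (t : ℕ) (x : Q) :
    q.pairPow y z t x = ((q.act z * q.act y) ^ t) x := by
  rw [← Equiv.Perm.iterate_eq_pow]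
  rfl

lemma genClosure_subset {S T : Set Q} (hS : S ⊆ T)
    (hT : ∀ x ∈ T, ∀ s ∈ S, q.act s x ∈ T ∧ (q.act s)⁻¹ x ∈ T) : q.genClosure S ⊆ T :=
  Set.sInter_subset_of_mem ⟨hS, hT⟩

end LinkQuandle

section Orbit

variable {Q : Type*} {A R C : Equiv.Perm Q} {a : Q} {k : ℕ}

/-- Powers of `R ^ k` act on `a` as powers of `C ^ (-2)` when `C ^ 2 * R ^ k` fixes `a`. -/
lemma zpow_mul_zpow_apply_add (hcomm : Commute C R) (hfix : (C ^ 2 * R ^ k) a = a)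
    (i j m : ℤ) : (C ^ i * R ^ (j + k * m)) a = (C ^ (i - 2 * m) * R ^ j) a := by
  have hU : ((C ^ 2 * R ^ k) ^ m) a = a :=
    Equiv.Perm.zpow_apply_eq_self_of_apply_eq_self hfix m
  have hUm : (C ^ 2 * R ^ k) ^ m = C ^ (2 * m) * R ^ ((k : ℤ) * m) := by
    rw [(hcomm.pow_pow 2 k).mul_zpow, zpow_mul, zpow_mul]
    norm_cast
  have key : C ^ i * R ^ (j + k * m) = C ^ (i - 2 * m) * R ^ j * (C ^ 2 * R ^ k) ^ m := by
    rw [hUm, zpow_sub, zpow_add, mul_assoc _ (R ^ j), ← mul_assoc (R ^ j) (C ^ (2 * m)),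
      ← (hcomm.zpow_zpow (2 * m) j).eq]
    group
  rw [key, Equiv.Perm.mul_apply, hU]

lemma apply_zpow_mul_zpow_apply (hcomm : Commute C R) (hfix : (C ^ 2 * R ^ k) a = a)
    (hAR : SemiconjBy A R R⁻¹) (hAC : SemiconjBy A C (C * R ^ k)) (hAa : A a = a) (i j : ℤ) :
    A ((C ^ i * R ^ j) a) = (C ^ (-i) * R ^ (-j)) a := by
  have h : SemiconjBy A (C ^ i * R ^ j) (C ^ i * R ^ (-j + k * i)) := by
    have := (hAC.zpow_right i).mul_right (hAR.zpow_right j)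
    rw [(hcomm.pow_right k).mul_zpow] at this
    rwa [mul_assoc, inv_zpow', ← zpow_natCast, ← zpow_mul, ← zpow_add, add_comm] at this
  have h' := congrArg (fun g : Equiv.Perm Q => g a) h.eq
  simp only [Equiv.Perm.mul_apply A, Equiv.Perm.mul_apply _ A, hAa] at h'
  rw [h', zpow_mul_zpow_apply_add hcomm hfix]
  congr 3
  ring

/-- The orbit of `a` under `⟨C, R⟩` is the image of an `n × k` box of exponents. -/
lemma zpow_mul_zpow_apply_mem_image {n : ℕ} (hn : 0 < n) (hk : 0 < k) (hcomm : Commute C R)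
    (hfix : (C ^ 2 * R ^ k) a = a) (hC : C ^ n = 1) (i j : ℤ) :
    (C ^ i * R ^ j) a ∈ (fun p : ℕ × ℕ => (C ^ p.1 * R ^ p.2) a) ''
      (Finset.range n ×ˢ Finset.range k : Finset (ℕ × ℕ)) := by
  obtain ⟨r, hr⟩ := Int.eq_ofNat_of_zero_le (Int.emod_nonneg j (b := k) (by omega))
  have hrk := Int.emod_lt_of_pos j (b := k) (by omega)
  set l := i - 2 * (j / k)
  obtain ⟨s, hs⟩ := Int.eq_ofNat_of_zero_le (Int.emod_nonneg l (b := n) (by omega))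
  have hsn := Int.emod_lt_of_pos l (b := n) (by omega)
  refine ⟨(s, r), by simp; omega, ?_⟩
  have hCl : C ^ l = C ^ s := by
    rw [← Int.emod_add_mul_ediv l n, hs, zpow_add, zpow_mul, zpow_natCast, zpow_natCast, hC,
      one_zpow, mul_one]
  rw [← Int.emod_add_mul_ediv j k, zpow_mul_zpow_apply_add hcomm hfix, hr, hCl, zpow_natCast]

end Orbit

theorem stmt8 {Q : Type*} (q : LinkQuandle Q) (a b c : Q) (n t : ℕ) (hn : 2 ≤ n)
    (h1 : q.op (q.op c a) b = c)
    (h2 : q.op (q.op (q.pairPow b a t a) b) c = b)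
    (h3 : q.op (q.pairPow a b t b) c = a)
    (ha : ∀ x : Q, q.op (q.op x a) a = x)
    (hb : ∀ x : Q, q.op (q.op x b) b = x)
    (hc : ∀ x : Q, q.opPow c n x = x) :
    (q.genClosure {a, b, c}).Finite ∧
    (q.genClosure {a, b, c}).ncard ≤ n * (2 * t + 1) + 2 := by
  set A := q.act a
  set B := q.act b
  set C := q.act c
  set R := B * A with hR
  have hA2 : A * A = 1 := Equiv.ext ha
  have hB2 : B * B = 1 := Equiv.ext hb
  have hAinv : A⁻¹ = A := inv_eq_of_mul_eq_one_left hA2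
  have hBinv : B⁻¹ = B := inv_eq_of_mul_eq_one_left hB2
  have hRinv : A * B = R⁻¹ := by rw [hR, mul_inv_rev, hAinv, hBinv]
  have hBR : B = R * A := by rw [hR, mul_assoc, hA2, mul_one]
  have hCn : C ^ n = 1 := Equiv.ext fun x => (q.opPow_eq c n x).symm.trans (hc x)
  have hAa : A a = a := q.idem a
  have hCc : C c = c := q.idem c
  have hRc : R c = c := h1
  have hmA : A ∈ q.translationNormalizer := q.act_mem_translationNormalizer a
  have hmB : B ∈ q.translationNormalizer := q.act_mem_translationNormalizer b
  have hmC : C ∈ q.translationNormalizer := q.act_mem_translationNormalizer c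
  have hmR : R ∈ q.translationNormalizer := mul_mem hmB hmA
  have hcomm : Commute C R := by
    have h := q.act_apply_of_mem hmR c
    rw [hRc] at h
    exact eq_mul_inv_iff_mul_eq.mp h
  have hAR : SemiconjBy A R R⁻¹ := by
    rw [SemiconjBy, ← hRinv, hR, mul_assoc]
  have hBRs : SemiconjBy B R R⁻¹ := by
    rw [SemiconjBy, ← hRinv, hR, ← mul_assoc, hB2, mul_assoc, hB2, one_mul, mul_one]
  have hab : C ((R ^ t) b) = a := by
    rw [q.pairPow_eq] at h3
    exact h3
  have hba : C ((R ^ (t + 1)) a) = b := by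
    rw [q.pairPow_eq] at h2
    have h : B * (A * B) ^ t = R ^ (t + 1) * A := by
      rw [hRinv, (hBRs.inv_right.pow_right t).eq, inv_inv, pow_succ, mul_assoc (R ^ t), ← hBR]
    have h' := congrArg (fun g : Equiv.Perm Q => C (g a)) h
    simp only [Equiv.Perm.mul_apply _ A, hAa] at h'
    exact h'.symm.trans h2
  have hfix : (C ^ 2 * R ^ (2 * t + 1)) a = a := by
    have h : C ^ 2 * R ^ (2 * t + 1) = C * R ^ t * (C * R ^ (t + 1)) := by
      rw [mul_assoc C, ← mul_assoc (R ^ t), ← (hcomm.pow_right t).eq, mul_assoc C, ← pow_add,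
        ← mul_assoc, sq]
      congr 2
      omega
    rw [h]
    simp only [Equiv.Perm.mul_apply, hba, hab]
  have hAC : SemiconjBy A C (C * R ^ (2 * t + 1)) := by
    have h := q.act_apply_of_mem (mul_mem hmC (pow_mem hmR t)) b
    rw [Equiv.Perm.mul_apply, hab] at h
    change A = C * R ^ t * B * (C * R ^ t)⁻¹ at h
    have h' : B * (R ^ t)⁻¹ = R ^ t * B := by
      rw [← inv_pow, (hBRs.inv_right.pow_right t).eq, inv_inv]
    rw [mul_inv_rev, ← mul_assoc, mul_assoc (C * R ^ t), h', eq_mul_inv_iff_mul_eq] at h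
    rw [SemiconjBy, h, hBR]
    simp only [← mul_assoc]
    rw [mul_assoc C, ← pow_add, mul_assoc C, ← pow_succ]
    congr 3
    omega
  have hCAc : C (A c) = A c := by
    have h : A * C = C * A * (R ^ (2 * t + 1))⁻¹ := by
      rw [hAC.eq, mul_assoc C, mul_assoc C, ← inv_pow,
        (hAR.inv_right.pow_right (2 * t + 1)).eq, inv_inv]
    have hR' : ((R ^ (2 * t + 1))⁻¹) c = c := by
      rw [Equiv.Perm.inv_eq_iff_eq, Equiv.Perm.pow_apply_eq_self_of_apply_eq_self hRc]
    have h' := congrArg (fun g : Equiv.Perm Q => g c) h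
    simp only [Equiv.Perm.mul_apply, hCc, hR'] at h'
    exact h'.symm
  have hBAc : B (A c) = c := h1
  have hBc : B c = A c := by
    rw [← hBinv, Equiv.Perm.inv_eq_iff_eq, hBAc]
  have hAAc : A (A c) = c := ha c
  let P := (fun p : ℕ × ℕ => (C ^ p.1 * R ^ p.2) a) ''
    (Finset.range n ×ˢ Finset.range (2 * t + 1) : Finset (ℕ × ℕ))
  have hP (i j : ℤ) : (C ^ i * R ^ j) a ∈ P :=
    zpow_mul_zpow_apply_mem_image (by omega) (by omega) hcomm hfix hCn i j
  have hAf := apply_zpow_mul_zpow_apply hcomm hfix hAR hAC hAa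
  have hAP (i j : ℤ) : A ((C ^ i * R ^ j) a) ∈ P := hAf i j ▸ hP _ _
  have hBP (i j : ℤ) : B ((C ^ i * R ^ j) a) ∈ P := by
    rw [hBR, Equiv.Perm.mul_apply, hAf, ← Equiv.Perm.mul_apply, ← mul_assoc,
      ← (hcomm.zpow_left (-i)).eq, mul_assoc, ← zpow_one_add]
    exact hP _ _
  have hCP (i j : ℤ) : C ((C ^ i * R ^ j) a) ∈ P := by
    rw [← Equiv.Perm.mul_apply, ← mul_assoc, ← zpow_one_add]
    exact hP _ _
  have hCP' (i j : ℤ) : C⁻¹ ((C ^ i * R ^ j) a) ∈ P := by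
    rw [← Equiv.Perm.mul_apply, ← mul_assoc, ← zpow_neg_one, ← zpow_add]
    exact hP _ _
  have hsub : q.genClosure {a, b, c} ⊆ insert c (insert (A c) P) := by
    apply q.genClosure_subset
    · rintro x (rfl | rfl | rfl)
      · exact Or.inr (Or.inr (by simpa using hP 0 0))
      · refine Or.inr (Or.inr ?_)
        rw [← hba]
        exact_mod_cast hP 1 (t + 1)
      · exact Or.inl rfl
    · rintro x (rfl | rfl | ⟨⟨i, j⟩, -, rfl⟩) s (rfl | rfl | rfl)
      · change A _ ∈ _ ∧ A⁻¹ _ ∈ _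
        simp [hAinv]
      · change B _ ∈ _ ∧ B⁻¹ _ ∈ _
        simp [hBinv, hBc]
      · change C _ ∈ _ ∧ C⁻¹ _ ∈ _
        simp [hCc, Equiv.Perm.inv_eq_iff_eq.mpr hCc.symm]
      · change A _ ∈ _ ∧ A⁻¹ _ ∈ _
        simp [hAinv, hAAc]
      · change B _ ∈ _ ∧ B⁻¹ _ ∈ _
        simp [hBinv, hBAc]
      · change C _ ∈ _ ∧ C⁻¹ _ ∈ _
        simp [hCAc, Equiv.Perm.inv_eq_iff_eq.mpr hCAc.symm]
      · change A _ ∈ _ ∧ A⁻¹ _ ∈ _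
        rw [hAinv]
        exact (and_self_iff).mpr (Or.inr (Or.inr (mod_cast hAP i j)))
      · change B _ ∈ _ ∧ B⁻¹ _ ∈ _
        rw [hBinv]
        exact (and_self_iff).mpr (Or.inr (Or.inr (mod_cast hBP i j)))
      · exact ⟨Or.inr (Or.inr (mod_cast hCP i j)), Or.inr (Or.inr (mod_cast hCP' i j))⟩
  have hPfin : P.Finite := (Finset.finite_toSet _).image _
  have hPcard : P.ncard ≤ n * (2 * t + 1) := by
    refine (Set.ncard_image_le (Finset.finite_toSet _)).trans_eq ?_
    rw [Set.ncard_coe_finset, Finset.card_product, Finset.card_range, Finset.card_range]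
  have hfin : (insert c (insert (A c) P)).Finite := (hPfin.insert _).insert _
  refine ⟨hfin.subset hsub, (Set.ncard_le_ncard hsub hfin).trans ?_⟩
  have h₁ := Set.ncard_insert_le c (insert (A c) P)
  have h₂ := Set.ncard_insert_le (A c) P
  omega
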